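/- arXiv:0805.4739 — 2 statements merged into one kernel-verified Lean document; each statement's English description precedes it below -/
import Mathlib

section
/- Let E ⊆ [0,1]² be symmetric. The space C_E is path-connected. -/
open Set Filter Topology TopologicalSpace

noncomputable section

/-- The underlying set of the connected comb `C`: the unit square `[0,1] × [0,1]`. -/
def Comb : Type := unitInterval × unitInterval

namespace Comb

/-- `mk x y` is the point `(x, y)` of the comb. -/
def mk (x y : unitInterval) : Comb := (x, y)

/-- The prescribed basic neighbourhoods `U(x,y,n)`:
for `y = 0` it is `(((x − 2⁻ⁿ, x + 2⁻ⁿ) ∩ [0,1]) × [0,1]) \ ({x} × [2⁻ⁿ, 1])`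
(the intersections with `[0,1]` are automatic since coordinates are in `unitInterval`),
and for `y > 0` it is `{x} × ((y − 2⁻ⁿ, y + 2⁻ⁿ) ∩ [0,1])`. -/
def U (p : Comb) (n : ℕ) : Set Comb :=
  if (p.2 : ℝ) = 0 then
    {q : Comb | (q.1 : ℝ) ∈ Set.Ioo ((p.1 : ℝ) - 2 ^ (-(n : ℤ))) ((p.1 : ℝ) + 2 ^ (-(n : ℤ)))} \
      {q : Comb | q.1 = p.1 ∧ (q.2 : ℝ) ∈ Set.Icc ((2 : ℝ) ^ (-(n : ℤ))) 1}
  else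
    {q : Comb | q.1 = p.1 ∧
      (q.2 : ℝ) ∈ Set.Ioo ((p.2 : ℝ) - 2 ^ (-(n : ℤ))) ((p.2 : ℝ) + 2 ^ (-(n : ℤ)))}

/-- The neighbourhood filter at `p` generated by the basic neighbourhoods `U p n`. -/
def nhdsFun (p : Comb) : Filter Comb := ⨅ n : ℕ, 𝓟 (U p n)

/-- The comb topology: the topology determined by the prescribed neighbourhood bases
(a set is open iff it is a neighbourhood, in the sense of the prescribed bases,
of each of its points). -/
instance : TopologicalSpace Comb := TopologicalSpace.mkOfNhds nhdsFun

end Comb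

namespace Comb

/-- The cross-shaped set `D_{x,a} = ({x} × [a,1] × C) ∪ (C × {x} × [a,1]) ⊆ C × C`. -/
def Dset (x : unitInterval) (a : ℝ) : Set (Comb × Comb) :=
  {p : Comb × Comb | p.1.1 = x ∧ (p.1.2 : ℝ) ∈ Set.Icc a 1} ∪
  {p : Comb × Comb | p.2.1 = x ∧ (p.2.2 : ℝ) ∈ Set.Icc a 1}

/-- A subset `E` of the unit square is symmetric if `(x,y) ∈ E ↔ (y,x) ∈ E` for all `x, y`. -/
def SymmSet (E : Set (unitInterval × unitInterval)) : Prop :=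
  ∀ x y : unitInterval, (x, y) ∈ E ↔ (y, x) ∈ E

/-- The open set `⋃_{(x,y) ∉ E} ({x} × (0,1]) × ({y} × (0,1])` that is removed from `C × C`. -/
def removedSet (E : Set (unitInterval × unitInterval)) : Set (Comb × Comb) :=
  ⋃ q ∈ Eᶜ, {p : Comb × Comb | p.1.1 = q.1 ∧ (p.1.2 : ℝ) ∈ Set.Ioc 0 1 ∧
    p.2.1 = q.2 ∧ (p.2.2 : ℝ) ∈ Set.Ioc 0 1}

/-- The space `C_E`: the complement in `C × C` of the removed set. -/
def CE (E : Set (unitInterval × unitInterval)) : Set (Comb × Comb) := (removedSet E)ᶜ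

/-- `D^E_{x,a} = D_{x,a} ∩ C_E`. -/
def DE (E : Set (unitInterval × unitInterval)) (x : unitInterval) (a : ℝ) :
    Set (Comb × Comb) := Dset x a ∩ CE E

/-- The base square `S = {(x,0,y,0) : x, y ∈ [0,1]}` of `C × C`. -/
def baseSquare : Set (Comb × Comb) :=
  {p : Comb × Comb | (p.1.2 : ℝ) = 0 ∧ (p.2.2 : ℝ) = 0}

end Comb

namespace Comb

/-- A map into the comb is continuous if it tends to each of its values along the prescribed
neighbourhoods. -/
theorem continuous_of_eventually_mem_U {X : Type*} [TopologicalSpace X] {f : X → Comb}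
    (h : ∀ t n, ∀ᶠ s in 𝓝 t, f s ∈ U (f t) n) : Continuous f := by
  refine continuous_def.2 fun s hs => isOpen_iff_mem_nhds.2 fun t ht => ?_
  have ht' : Tendsto f (𝓝 t) (nhdsFun (f t)) :=
    tendsto_iInf.2 fun n => tendsto_principal.2 (h t n)
  exact ht' (hs _ ht)

/-- The inclusion of the base line into the comb is continuous. -/
theorem continuous_mk_zero : Continuous fun x : unitInterval => mk x 0 := by
  refine continuous_of_eventually_mem_U fun t n => ?_
  have hpos : (0 : ℝ) < 2 ^ (-(n : ℤ)) := by positivity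
  have hev : ∀ᶠ s : unitInterval in 𝓝 t,
      (s : ℝ) ∈ Set.Ioo ((t : ℝ) - 2 ^ (-(n : ℤ))) ((t : ℝ) + 2 ^ (-(n : ℤ))) :=
    continuous_subtype_val.continuousAt (Ioo_mem_nhds (by linarith) (by linarith))
  filter_upwards [hev] with s hs
  rw [U, if_pos (by simp [mk])]
  exact ⟨hs, fun h => absurd h.2.1 (not_le.2 (by simp [mk]))⟩

/-- The inclusion of a vertical segment into the comb is continuous. -/
theorem continuous_mk_right (x : unitInterval) : Continuous (mk x) := by
  refine continuous_of_eventually_mem_U fun t n => ?_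
  have hpos : (0 : ℝ) < 2 ^ (-(n : ℤ)) := by positivity
  have hev : ∀ᶠ s : unitInterval in 𝓝 t,
      (s : ℝ) ∈ Set.Ioo ((t : ℝ) - 2 ^ (-(n : ℤ))) ((t : ℝ) + 2 ^ (-(n : ℤ))) :=
    continuous_subtype_val.continuousAt (Ioo_mem_nhds (by linarith) (by linarith))
  filter_upwards [hev] with s hs
  by_cases ht : (t : ℝ) = 0
  · rw [U, if_pos (show ((mk x t).2 : ℝ) = 0 from ht)]
    refine ⟨⟨sub_lt_self _ hpos, lt_add_of_pos_right _ hpos⟩, fun h => ?_⟩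
    have h1 : (2 : ℝ) ^ (-(n : ℤ)) ≤ s := h.2.1
    have h2 := hs.2
    rw [ht, zero_add] at h2
    exact absurd h1 (not_le.2 h2)
  · rw [U, if_neg (show ¬((mk x t).2 : ℝ) = 0 from ht)]
    exact ⟨rfl, hs⟩

/-- `C_E` is stable under scaling both heights by a common factor. -/
theorem mk_mul_mem_CE {E : Set (unitInterval × unitInterval)} {p : Comb × Comb} (hp : p ∈ CE E)
    (t : unitInterval) : (mk p.1.1 (t * p.1.2), mk p.2.1 (t * p.2.2)) ∈ CE E := by
  have pos_of_mul : ∀ a : unitInterval, 0 < ((t * a : unitInterval) : ℝ) → (0 : ℝ) < a :=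
    fun a ha => pos_of_mul_pos_right (by simpa using ha) t.2.1
  intro hmem
  apply hp
  simp only [removedSet, mem_iUnion, exists_prop] at hmem ⊢
  obtain ⟨q, hq, h1, h2, h3, h4⟩ := hmem
  exact ⟨q, hq, h1, ⟨pos_of_mul _ h2.1, p.1.2.2.2⟩, h3, ⟨pos_of_mul _ h4.1, p.2.2.2.2⟩⟩

/-- The base square is contained in `C_E`. -/
theorem mk_zero_mem_CE (E : Set (unitInterval × unitInterval)) (x y : unitInterval) :
    (mk x 0, mk y 0) ∈ CE E := by
  intro hmem
  simp only [removedSet, mem_iUnion, exists_prop] at hmem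
  obtain ⟨q, -, -, h, -⟩ := hmem
  exact lt_irrefl (0 : ℝ) h.1

/-- Every point of `C_E` can be joined inside `C_E` to its projection to the base square. -/
theorem joinedIn_CE_base {E : Set (unitInterval × unitInterval)} {p : Comb × Comb}
    (hp : p ∈ CE E) : JoinedIn (CE E) (mk p.1.1 0, mk p.2.1 0) p :=
  ⟨{ toFun := fun t => (mk p.1.1 (t * p.1.2), mk p.2.1 (t * p.2.2))
     continuous_toFun :=
      ((continuous_mk_right p.1.1).comp (continuous_id.mul continuous_const)).prodMk
        ((continuous_mk_right p.2.1).comp (continuous_id.mul continuous_const))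
     source' := by simp
     target' := by simp only [one_mul]; rfl }, mk_mul_mem_CE hp⟩

/-- Every point of the base square can be joined to the corner inside `C_E`. -/
theorem joinedIn_CE_corner (E : Set (unitInterval × unitInterval)) (x y : unitInterval) :
    JoinedIn (CE E) (mk 0 0, mk 0 0) (mk x 0, mk y 0) :=
  ⟨{ toFun := fun t => (mk (t * x) 0, mk (t * y) 0)
     continuous_toFun :=
      (continuous_mk_zero.comp (continuous_id.mul continuous_const)).prodMk
        (continuous_mk_zero.comp (continuous_id.mul continuous_const))
     source' := by simp
     target' := by simp }, fun t => mk_zero_mem_CE E (t * x) (t * y)⟩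

end Comb

/-- Let `E ⊆ [0,1]²` be symmetric. The space `C_E` is path-connected. -/
theorem CE_pathConnectedSpace (E : Set (unitInterval × unitInterval))
    (hE : Comb.SymmSet E) :
    PathConnectedSpace ↥(Comb.CE E) := by
  exact isPathConnected_iff_pathConnectedSpace.1 ⟨(Comb.mk 0 0, Comb.mk 0 0),
    Comb.mk_zero_mem_CE E 0 0,
    fun {p} hp => (Comb.joinedIn_CE_corner E p.1.1 p.2.1).trans (Comb.joinedIn_CE_base hp)⟩
end
end

section
/- Let E ⊆ [0,1]² be symmetric and let X ⊆ [0,1] be such that E ⊆ X×X. Suppose there is NO map φ : X → P(ℕ) such that for all distinct x, y ∈ X the set φ(x) ∩ φ(y) is infinite if and only if (x,y) ∈ E. Then C_E is not a continuous image of N*, i.e., there is no continuous surjection from N* onto C_E. -/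
open Set Filter Topology TopologicalSpace

noncomputable section

/-- `ℕ* = βℕ \ ℕ`: the remainder of the Čech–Stone compactification of the discrete
space `ℕ`, realized as the space of free ultrafilters on `ℕ`. -/
def NStar : Set (Ultrafilter ℕ) := (Set.range (pure : ℕ → Ultrafilter ℕ))ᶜ

namespace Comb

/-- The height function of the tooth at `x`, extended by zero to the other teeth. -/
def toothHeight (x : unitInterval) (q : Comb) : ℝ :=
  open Classical in if q.1 = x then (q.2 : ℝ) else 0

theorem toothHeight_of_eq {x : unitInterval} {q : Comb} (h : q.1 = x) :
    toothHeight x q = q.2 := if_pos h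

theorem toothHeight_of_ne {x : unitInterval} {q : Comb} (h : q.1 ≠ x) :
    toothHeight x q = 0 := if_neg h

theorem toothHeight_nonneg (x : unitInterval) (q : Comb) : 0 ≤ toothHeight x q := by
  unfold toothHeight
  split_ifs
  · exact q.2.2.1
  · exact le_rfl

theorem exists_two_zpow_neg_lt {ε : ℝ} (hε : 0 < ε) : ∃ n : ℕ, (2 : ℝ) ^ (-(n : ℤ)) < ε := by
  obtain ⟨n, hn⟩ := exists_pow_lt_of_lt_one hε (by norm_num : (2⁻¹ : ℝ) < 1)
  exact ⟨n, by simpa [zpow_neg, inv_pow] using hn⟩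

/-- Every point has a prescribed basic neighbourhood on which `toothHeight x` varies by less
than `ε`. -/
theorem exists_U_toothHeight_sub_lt (x : unitInterval) (p : Comb) {ε : ℝ} (hε : 0 < ε) :
    ∃ n : ℕ, ∀ q ∈ U p n, |toothHeight x q - toothHeight x p| < ε := by
  by_cases hp : (p.2 : ℝ) = 0
  · by_cases hx : p.1 = x
    · obtain ⟨n, hn⟩ := exists_two_zpow_neg_lt hε
      refine ⟨n, fun q hq => ?_⟩
      rw [U, if_pos hp] at hq
      rw [toothHeight_of_eq hx, hp, sub_zero, abs_of_nonneg (toothHeight_nonneg x q)]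
      by_cases hqx : q.1 = x
      · rw [toothHeight_of_eq hqx]
        by_contra! hle
        exact hq.2 ⟨hqx.trans hx.symm, hn.le.trans hle, q.2.2.2⟩
      · rwa [toothHeight_of_ne hqx]
    · have hd : 0 < |(x : ℝ) - p.1| :=
        abs_pos.2 (sub_ne_zero.2 fun h => hx (Subtype.ext h.symm))
      obtain ⟨n, hn⟩ := exists_two_zpow_neg_lt hd
      refine ⟨n, fun q hq => ?_⟩
      rw [U, if_pos hp] at hq
      have hqx : q.1 ≠ x := by
        intro h
        have h1 := hq.1
        simp only [Set.mem_ofPred_eq, Set.mem_Ioo, h] at h1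
        have : |(x : ℝ) - p.1| < 2 ^ (-(n : ℤ)) := abs_lt.2 ⟨by linarith, by linarith⟩
        linarith
      simpa [toothHeight_of_ne hqx, toothHeight_of_ne hx] using hε
  · obtain ⟨n, hn⟩ := exists_two_zpow_neg_lt hε
    refine ⟨n, fun q hq => ?_⟩
    rw [U, if_neg hp] at hq
    obtain ⟨h1, h2, h3⟩ := hq
    by_cases hx : p.1 = x
    · rw [toothHeight_of_eq hx, toothHeight_of_eq (h1.trans hx), abs_lt]
      constructor <;> linarith
    · simpa [toothHeight_of_ne hx, toothHeight_of_ne (h1 ▸ hx : q.1 ≠ x)] using hε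

theorem continuous_toothHeight (x : unitInterval) : Continuous (toothHeight x) := by
  refine ⟨fun s hs p hp => ?_⟩
  obtain ⟨ε, hε, hs⟩ := Metric.isOpen_iff.1 hs _ hp
  obtain ⟨n, hn⟩ := exists_U_toothHeight_sub_lt x p hε
  refine Filter.mem_iInf_of_mem n (Filter.mem_principal.2 fun q hq => hs ?_)
  rw [Metric.mem_ball, Real.dist_eq]
  exact hn q hq

/-- The larger of the heights of the two coordinates over the tooth at `x`; its superlevel sets
are the sets `Dset x a`. -/
def crossHeight (x : unitInterval) (p : Comb × Comb) : ℝ :=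
  max (toothHeight x p.1) (toothHeight x p.2)

theorem continuous_crossHeight (x : unitInterval) : Continuous (crossHeight x) :=
  ((continuous_toothHeight x).comp continuous_fst).max
    ((continuous_toothHeight x).comp continuous_snd)

theorem of_toothHeight_pos {x : unitInterval} {q : Comb} (h : 0 < toothHeight x q) :
    q.1 = x ∧ (q.2 : ℝ) ∈ Set.Ioc 0 1 := by
  by_cases hx : q.1 = x
  · exact ⟨hx, toothHeight_of_eq hx ▸ h, q.2.2.2⟩
  · exact absurd h (toothHeight_of_ne hx ▸ lt_irrefl _)

theorem mem_of_mem_CE {E : Set (unitInterval × unitInterval)} {p : Comb × Comb}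
    (hp : p ∈ CE E) {x y : unitInterval} (hx : 0 < toothHeight x p.1)
    (hy : 0 < toothHeight y p.2) : (x, y) ∈ E := by
  by_contra h
  obtain ⟨h1, h2⟩ := of_toothHeight_pos hx
  obtain ⟨h3, h4⟩ := of_toothHeight_pos hy
  exact hp (Set.mem_biUnion (x := (x, y)) h ⟨h1, h2, h3, h4⟩)

theorem mem_of_crossHeight_pos {E : Set (unitInterval × unitInterval)} (hE : SymmSet E)
    {p : Comb × Comb} (hp : p ∈ CE E) {x y : unitInterval} (hxy : x ≠ y)
    (hx : 0 < crossHeight x p) (hy : 0 < crossHeight y p) : (x, y) ∈ E := by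
  rcases lt_max_iff.1 hx with hx | hx <;> rcases lt_max_iff.1 hy with hy | hy
  · exact absurd ((of_toothHeight_pos hx).1.symm.trans (of_toothHeight_pos hy).1) hxy
  · exact mem_of_mem_CE hp hx hy
  · exact (hE x y).2 (mem_of_mem_CE hp hy hx)
  · exact absurd ((of_toothHeight_pos hx).1.symm.trans (of_toothHeight_pos hy).1) hxy

theorem mk_one_mem_CE {E : Set (unitInterval × unitInterval)} {x y : unitInterval}
    (h : (x, y) ∈ E) : (mk x 1, mk y 1) ∈ CE E := by
  intro hmem
  obtain ⟨q, hq, h1, -, h2, -⟩ := Set.mem_iUnion₂.1 hmem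
  have : (x, y) = q := Prod.ext h1 h2
  exact hq (this ▸ h)

theorem toothHeight_mk_one (x : unitInterval) : toothHeight x (mk x 1) = 1 :=
  toothHeight_of_eq rfl

end Comb

theorem isClosed_NStar : IsClosed NStar := by
  refine ⟨?_⟩
  rw [NStar, compl_compl, ← Set.iUnion_singleton_eq_range]
  refine isOpen_iUnion fun n => ?_
  convert ultrafilter_isOpen_basic ({n} : Set ℕ) using 1
  ext u
  simp only [Set.mem_singleton_iff, Set.mem_ofPred_eq]
  refine ⟨fun h => h ▸ Filter.mem_pure.2 rfl, fun h => ?_⟩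
  obtain ⟨m, hm, rfl⟩ := Ultrafilter.eq_pure_of_finite_mem (Set.finite_singleton n) h
  rw [Set.mem_singleton_iff.1 hm]

/-- A closed subset of `ℕ*` can be separated from the complement of an open neighbourhood by
a set of the form `A*`. -/
theorem exists_set_separating {K V : Set NStar} (hK : IsClosed K) (hV : IsOpen V)
    (hKV : K ⊆ V) :
    ∃ A : Set ℕ, (∀ u ∈ K, A ∈ u.1) ∧ ∀ u : NStar, A ∈ u.1 → u ∈ V := by
  have : CompactSpace NStar := isCompact_iff_compactSpace.1 isClosed_NStar.isCompact
  refine hK.isCompact.induction_on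
    (p := fun s => ∃ A : Set ℕ, (∀ u ∈ s, A ∈ u.1) ∧ ∀ u : NStar, A ∈ u.1 → u ∈ V)
    ⟨∅, by simp, fun u hu => absurd hu u.1.empty_notMem⟩ ?_ ?_ ?_
  · rintro s t hst ⟨A, hA, hAV⟩
    exact ⟨A, fun u hu => hA u (hst hu), hAV⟩
  · rintro s t ⟨A, hA, hAV⟩ ⟨B, hB, hBV⟩
    refine ⟨A ∪ B, ?_, fun u hu => ?_⟩
    · rintro u (hu | hu)
      · exact Filter.mem_of_superset (hA u hu) Set.subset_union_left
      · exact Filter.mem_of_superset (hB u hu) Set.subset_union_right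
    · exact (Ultrafilter.union_mem_iff.1 hu).elim (hAV u) (hBV u)
  · intro u hu
    obtain ⟨W, hW, rfl⟩ := isOpen_induced_iff.1 hV
    obtain ⟨_, ⟨A, rfl⟩, hA, hAW⟩ :=
      ultrafilterBasis_is_basis.exists_subset_of_mem_open (hKV hu) hW
    refine ⟨Subtype.val ⁻¹' {v : Ultrafilter ℕ | A ∈ v}, mem_nhdsWithin_of_mem_nhds ?_, A,
      fun v hv => hv, fun v hv => hAW hv⟩
    exact ((ultrafilter_isOpen_basic A).preimage continuous_subtype_val).mem_nhds hA

theorem infinite_iff_exists_mem_NStar {A : Set ℕ} : A.Infinite ↔ ∃ u : NStar, A ∈ u.1 := by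
  constructor
  · intro hA
    have : (Filter.cofinite ⊓ 𝓟 A).NeBot := Filter.cofinite_inf_principal_neBot_iff.2 hA
    have hle := Ultrafilter.of_le (Filter.cofinite ⊓ 𝓟 A)
    refine ⟨⟨Ultrafilter.of (Filter.cofinite ⊓ 𝓟 A), ?_⟩,
      hle (Filter.mem_inf_of_right (Filter.mem_principal_self A))⟩
    rintro ⟨n, hn⟩
    have h : ({n}ᶜ : Set ℕ) ∈ Ultrafilter.of (Filter.cofinite ⊓ 𝓟 A) :=
      hle (Filter.mem_inf_of_left (Set.finite_singleton n).compl_mem_cofinite)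
    rw [← hn] at h
    exact Filter.mem_pure.1 h rfl
  · rintro ⟨u, hu⟩ hfin
    obtain ⟨n, -, hn⟩ := Ultrafilter.eq_pure_of_finite_mem hfin hu
    exact u.2 ⟨n, hn.symm⟩

/-- Let `E ⊆ [0,1]²` be symmetric with `E ⊆ X × X`. If there is NO map
`φ : X → 𝒫(ℕ)` such that for all distinct `x, y ∈ X` the set `φ x ∩ φ y` is infinite
iff `(x,y) ∈ E`, then `C_E` is not a continuous image of `ℕ*`. -/
theorem CE_not_NStar_image (E : Set (unitInterval × unitInterval))
    (hE : Comb.SymmSet E) (X : Set unitInterval) (hEX : E ⊆ X ×ˢ X)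
    (hrep : ¬ ∃ φ : ↥X → Set ℕ, ∀ x y : ↥X, x ≠ y →
      ((φ x ∩ φ y).Infinite ↔ ((x : unitInterval), (y : unitInterval)) ∈ E)) :
    ¬ ∃ g : ↥NStar → ↥(Comb.CE E), Continuous g ∧ Function.Surjective g := by
  rintro ⟨g, hg, hsurj⟩
  have hcont (x : unitInterval) : Continuous fun u => Comb.crossHeight x (g u).1 :=
    (Comb.continuous_crossHeight x).comp (continuous_subtype_val.comp hg)
  have hsep (x : unitInterval) : ∃ A : Set ℕ,
      (∀ u : NStar, 1 ≤ Comb.crossHeight x (g u).1 → A ∈ u.1) ∧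
        ∀ u : NStar, A ∈ u.1 → 0 < Comb.crossHeight x (g u).1 :=
    exists_set_separating (isClosed_le continuous_const (hcont x))
      (isOpen_lt continuous_const (hcont x))
      fun u (hu : (1 : ℝ) ≤ _) => (zero_lt_one.trans_le hu : (0 : ℝ) < _)
  choose φ hφ₁ hφ₀ using hsep
  refine hrep ⟨fun x => φ x, fun x y hxy => ?_⟩
  rw [infinite_iff_exists_mem_NStar]
  constructor
  · rintro ⟨u, hu⟩
    obtain ⟨hx, hy⟩ := Filter.inter_mem_iff.1 hu
    exact Comb.mem_of_crossHeight_pos hE (g u).2 (Subtype.coe_ne_coe.2 hxy)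
      (hφ₀ x u hx) (hφ₀ y u hy)
  · intro h
    obtain ⟨u, hu⟩ := hsurj ⟨_, Comb.mk_one_mem_CE h⟩
    refine ⟨u, Filter.inter_mem (hφ₁ x u ?_) (hφ₁ y u ?_)⟩ <;> rw [hu]
    · exact le_max_of_le_left (Comb.toothHeight_mk_one _).ge
    · exact le_max_of_le_right (Comb.toothHeight_mk_one _).ge
end
end
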